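/- Smith's theorem: for a finite connected simple graph G, the index λ_max(G) satisfies λ_max < 2 if and only if G is one of the Dynkin graphs A_n, D_n, E₆, E₇, E₈, and λ_max = 2 if and only if G is one of the extended Dynkin graphs Ã_n, D̃_n, Ẽ₆, Ẽ₇, Ẽ₈. -/

import Mathlib

open SimpleGraph

/-- The Dynkin graph Dₘ (m ≥ 4): a path on vertices 1,…,m−1 together with the
extra vertex 0 joined to vertex 2. -/
def dynkinD (m : ℕ) : SimpleGraph (Fin m) :=
  SimpleGraph.fromRel (fun i j =>
    (1 ≤ i.val ∧ i.val + 1 = j.val) ∨ (i.val = 0 ∧ j.val = 2))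

/-- The Dynkin graph Eₘ (m = 6, 7, 8): a path on vertices 0,…,m−2 together with the
extra vertex m−1 joined to vertex 2. -/
def dynkinE (m : ℕ) : SimpleGraph (Fin m) :=
  SimpleGraph.fromRel (fun i j =>
    (i.val + 1 = j.val ∧ j.val ≤ m - 2) ∨ (i.val = 2 ∧ j.val = m - 1))

/-- The extended Dynkin graph D̃ₘ (m ≥ 4), on m+1 vertices: a central path
2,…,m−2 with vertices 0,1 joined to 2 and vertices m−1, m joined to m−2. -/
def extDynkinD (m : ℕ) : SimpleGraph (Fin (m + 1)) :=
  SimpleGraph.fromRel (fun i j =>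
    (2 ≤ i.val ∧ i.val + 1 = j.val ∧ j.val ≤ m - 2) ∨
    (i.val ≤ 1 ∧ j.val = 2) ∨
    (i.val = m - 2 ∧ (j.val = m - 1 ∨ j.val = m)))

/-- The extended Dynkin graph Ẽ₆ on 7 vertices: path 0–1–2–3–4 with 5 joined to 2
and 6 joined to 5. -/
def extDynkinE6 : SimpleGraph (Fin 7) :=
  SimpleGraph.fromRel (fun i j =>
    (i.val + 1 = j.val ∧ j.val ≤ 4) ∨ (i.val = 2 ∧ j.val = 5) ∨ (i.val = 5 ∧ j.val = 6))

/-- The extended Dynkin graph Ẽ₇ on 8 vertices: path 0–…–6 with 7 joined to 3. -/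
def extDynkinE7 : SimpleGraph (Fin 8) :=
  SimpleGraph.fromRel (fun i j =>
    (i.val + 1 = j.val ∧ j.val ≤ 6) ∨ (i.val = 3 ∧ j.val = 7))

/-- The extended Dynkin graph Ẽ₈ on 9 vertices: path 0–…–7 with 8 joined to 2. -/
def extDynkinE8 : SimpleGraph (Fin 9) :=
  SimpleGraph.fromRel (fun i j =>
    (i.val + 1 = j.val ∧ j.val ≤ 7) ∨ (i.val = 2 ∧ j.val = 8))

section Spectral

open scoped Matrix

variable {V : Type*} [Fintype V]

/-- The sum of the values of `x` over the neighbours of `v`. -/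
def nbrSum {R : Type*} [AddCommMonoid R] (G : SimpleGraph V) [DecidableRel G.Adj]
    (x : V → R) (v : V) : R :=
  ∑ u, if G.Adj v u then x u else 0

variable (G : SimpleGraph V) [DecidableRel G.Adj]

lemma adjMatrix_mulVec_eq_nbrSum (x : V → ℝ) : G.adjMatrix ℝ *ᵥ x = nbrSum G x := by
  ext v
  simp [Matrix.mulVec, dotProduct, nbrSum, adjMatrix_apply]

lemma sum_nbrSum_mul_comm (x y : V → ℝ) :
    ∑ v, nbrSum G x v * y v = ∑ v, x v * nbrSum G y v := by
  simp only [nbrSum, Finset.sum_mul, Finset.mul_sum]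
  rw [Finset.sum_comm]
  refine Finset.sum_congr rfl fun v _ => Finset.sum_congr rfl fun u _ => ?_
  simp [G.adj_comm u v]

lemma natCast_nbrSum (w : V → ℕ) (v : V) :
    ((nbrSum G w v : ℕ) : ℝ) = nbrSum G (fun u => (w u : ℝ)) v := by
  simp [nbrSum]

variable {G}

omit [Fintype V] [DecidableRel G.Adj] in
lemma SimpleGraph.Connected.forall_of_adj (hG : G.Connected) {P : V → Prop} {a : V} (ha : P a)
    (h : ∀ v w, P v → G.Adj v w → P w) (v : V) : P v := by
  obtain ⟨p⟩ := hG.preconnected a v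
  induction p with
  | nil => exact ha
  | cons hadj _ ih => exact ih (h _ _ ha hadj)

lemma eq_zero_of_nbrSum_le (hG : G.Connected) {z : V → ℝ} {c : ℝ} (hz : ∀ v, 0 ≤ z v)
    (h : ∀ v, nbrSum G z v ≤ c * z v) {a : V} (ha : z a = 0) (v : V) : z v = 0 := by
  refine hG.forall_of_adj (P := fun v => z v = 0) ha (fun v w hv hvw => ?_) v
  have h1 : z w ≤ nbrSum G z v := by
    have := Finset.single_le_sum (f := fun u => if G.Adj v u then z u else 0)
      (fun u _ => by split_ifs <;> simp [hz]) (Finset.mem_univ w)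
    rw [if_pos hvw] at this
    exact this
  have h2 := h v
  rw [hv, mul_zero] at h2
  exact le_antisymm (h1.trans h2) (hz w)

variable [DecidableEq V] (hA : (G.adjMatrix ℝ).IsHermitian)

lemma exists_index_eigenvector [Nonempty V] :
    ∃ x : V → ℝ, x ≠ 0 ∧ ∀ v, nbrSum G x v = (⨆ i, hA.eigenvalues i) * x v := by
  obtain ⟨i, hi⟩ := exists_eq_ciSup_of_finite (f := hA.eigenvalues)
  refine ⟨hA.eigenvectorBasis i, fun h => ?_, fun v => ?_⟩
  · exact hA.eigenvectorBasis.orthonormal.ne_zero i (by ext v; simpa using congrFun h v)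
  · rw [← adjMatrix_mulVec_eq_nbrSum, hA.mulVec_eigenvectorBasis, hi]
    simp

lemma posSemidef_index_sub_adjMatrix :
    ((⨆ i, hA.eigenvalues i) • (1 : Matrix V V ℝ) - G.adjMatrix ℝ).PosSemidef := by
  have hH : ((⨆ i, hA.eigenvalues i) • (1 : Matrix V V ℝ) - G.adjMatrix ℝ).IsHermitian := by
    refine Matrix.IsHermitian.sub ?_ hA
    simp [Matrix.IsHermitian]
  rw [hH.posSemidef_iff_eigenvalues_nonneg]
  intro i
  obtain ⟨μ, hμ⟩ : ∃ μ, μ = hH.eigenvalues i := ⟨_, rfl⟩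
  have h1 := hH.eigenvalues_mem_spectrum_real i
  rw [← hμ] at h1 ⊢
  rw [← Algebra.algebraMap_eq_smul_one, ← spectrum.singleton_sub_eq,
    hA.spectrum_real_eq_range_eigenvalues] at h1
  obtain ⟨_, rfl, _, ⟨j, rfl⟩, h⟩ := h1
  rw [← h]
  exact sub_nonneg.2 (le_ciSup (Set.finite_range _).bddAbove j)

lemma star_dotProduct_sub_mulVec (c : ℝ) (x : V → ℝ) :
    star x ⬝ᵥ ((c • (1 : Matrix V V ℝ) - G.adjMatrix ℝ) *ᵥ x) =
      c * ∑ v, x v * x v - ∑ v, x v * nbrSum G x v := by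
  rw [Matrix.sub_mulVec, dotProduct_sub, adjMatrix_mulVec_eq_nbrSum, Matrix.smul_mulVec,
    Matrix.one_mulVec, dotProduct_smul, smul_eq_mul]
  simp [dotProduct]

lemma sum_mul_nbrSum_le (x : V → ℝ) :
    ∑ v, x v * nbrSum G x v ≤ (⨆ i, hA.eigenvalues i) * ∑ v, x v * x v := by
  have h := (posSemidef_index_sub_adjMatrix hA).dotProduct_mulVec_nonneg x
  rw [star_dotProduct_sub_mulVec] at h
  linarith

lemma nbrSum_eq_of_sum_mul_nbrSum_eq {x : V → ℝ}
    (h : ∑ v, x v * nbrSum G x v = (⨆ i, hA.eigenvalues i) * ∑ v, x v * x v) (v : V) :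
    nbrSum G x v = (⨆ i, hA.eigenvalues i) * x v := by
  have h0 : star x ⬝ᵥ (((⨆ i, hA.eigenvalues i) • (1 : Matrix V V ℝ) - G.adjMatrix ℝ) *ᵥ x)
      = 0 := by
    rw [star_dotProduct_sub_mulVec]; linarith
  rw [(posSemidef_index_sub_adjMatrix hA).dotProduct_mulVec_zero_iff, Matrix.sub_mulVec,
    adjMatrix_mulVec_eq_nbrSum, Matrix.smul_mulVec, Matrix.one_mulVec, sub_eq_zero] at h0
  exact (congrFun h0 v).symm

variable [Nonempty V]

/-- The absolute value of an index eigenvector `x` satisfies `λ |x| ≤ A |x|`. -/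
lemma exists_nonneg_index_subsolution :
    ∃ y : V → ℝ, (∀ v, 0 ≤ y v) ∧ (∃ v, y v ≠ 0) ∧
      ∀ v, (⨆ i, hA.eigenvalues i) * y v ≤ nbrSum G y v := by
  obtain ⟨x, hx0, hx⟩ := exists_index_eigenvector hA
  obtain ⟨a, ha⟩ := Function.ne_iff.1 hx0
  refine ⟨fun v => |x v|, fun v => abs_nonneg _, ⟨a, by simpa using ha⟩, fun v => ?_⟩
  calc (⨆ i, hA.eigenvalues i) * |x v| ≤ |(⨆ i, hA.eigenvalues i) * x v| := by
        rw [abs_mul]; exact mul_le_mul_of_nonneg_right (le_abs_self _) (abs_nonneg _)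
    _ = |nbrSum G x v| := by rw [hx]
    _ ≤ nbrSum G (fun v => |x v|) v := by
        refine (Finset.abs_sum_le_sum_abs _ _).trans (Finset.sum_le_sum fun u _ => ?_)
        split_ifs <;> simp

lemma index_le_of_nbrSum_le {w : V → ℝ} (hw : ∀ v, 0 < w v) {c : ℝ}
    (h : ∀ v, nbrSum G w v ≤ c * w v) : (⨆ i, hA.eigenvalues i) ≤ c := by
  obtain ⟨y, hy, ⟨a, ha⟩, hly⟩ := exists_nonneg_index_subsolution hA
  have hpos : 0 < ∑ v, w v * y v :=
    Finset.sum_pos' (fun v _ => mul_nonneg (hw v).le (hy v))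
      ⟨a, Finset.mem_univ _, mul_pos (hw a) ((hy a).lt_of_ne' ha)⟩
  refine le_of_mul_le_mul_right ?_ hpos
  calc (⨆ i, hA.eigenvalues i) * ∑ v, w v * y v
      = ∑ v, w v * ((⨆ i, hA.eigenvalues i) * y v) := by
        rw [Finset.mul_sum]; exact Finset.sum_congr rfl fun _ _ => by ring
    _ ≤ ∑ v, w v * nbrSum G y v :=
        Finset.sum_le_sum fun v _ => mul_le_mul_of_nonneg_left (hly v) (hw v).le
    _ = ∑ v, nbrSum G w v * y v := (sum_nbrSum_mul_comm G w y).symm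
    _ ≤ ∑ v, c * w v * y v :=
        Finset.sum_le_sum fun v _ => mul_le_mul_of_nonneg_right (h v) (hy v)
    _ = c * ∑ v, w v * y v := by
        rw [Finset.mul_sum]; exact Finset.sum_congr rfl fun _ _ => by ring

lemma index_eq_of_nbrSum_eq {w : V → ℝ} (hw : ∀ v, 0 < w v) {c : ℝ}
    (h : ∀ v, nbrSum G w v = c * w v) : (⨆ i, hA.eigenvalues i) = c := by
  refine le_antisymm (index_le_of_nbrSum_le hA hw fun v => (h v).le) ?_
  have hpos : 0 < ∑ v, w v * w v :=
    Finset.sum_pos (fun v _ => mul_pos (hw v) (hw v)) Finset.univ_nonempty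
  refine le_of_mul_le_mul_right ((Eq.le ?_).trans (sum_mul_nbrSum_le hA w)) hpos
  rw [Finset.mul_sum]
  exact Finset.sum_congr rfl fun v _ => by rw [h]; ring

lemma index_lt_of_nbrSum_lt (hG : G.Connected) {w : V → ℝ} (hw : ∀ v, 0 < w v) {c : ℝ}
    (h : ∀ v, nbrSum G w v ≤ c * w v) {a : V} (ha : nbrSum G w a < c * w a) :
    (⨆ i, hA.eigenvalues i) < c := by
  refine (index_le_of_nbrSum_le hA hw h).lt_of_ne fun hc => ?_
  obtain ⟨y, hy, ⟨b, hb⟩, hly⟩ := exists_nonneg_index_subsolution hA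
  rw [hc] at hly
  have h1 : ∀ v ∈ Finset.univ, 0 ≤ (c * w v - nbrSum G w v) * y v := fun v _ =>
    mul_nonneg (sub_nonneg.2 (h v)) (hy v)
  have h2 : ∀ v ∈ Finset.univ, 0 ≤ w v * (nbrSum G y v - c * y v) := fun v _ =>
    mul_nonneg (hw v).le (sub_nonneg.2 (hly v))
  have h3 : ∑ v, (c * w v - nbrSum G w v) * y v + ∑ v, w v * (nbrSum G y v - c * y v) = 0 := by
    have := sum_nbrSum_mul_comm G w y
    simp only [sub_mul, mul_sub, Finset.sum_sub_distrib, this]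
    rw [Finset.sum_congr rfl fun v _ => show c * w v * y v = w v * (c * y v) by ring]
    ring
  have h4 := (Finset.sum_eq_zero_iff_of_nonneg h1).1
    (by linarith [Finset.sum_nonneg h1, Finset.sum_nonneg h2])
  have h5 := (Finset.sum_eq_zero_iff_of_nonneg h2).1
    (by linarith [Finset.sum_nonneg h1, Finset.sum_nonneg h2])
  have hya : y a = 0 :=
    (mul_eq_zero.1 (h4 a (Finset.mem_univ a))).resolve_left (sub_pos.2 ha).ne'
  refine hb (eq_zero_of_nbrSum_le (c := c) hG hy (fun v => ?_) hya b)
  have := (mul_eq_zero.1 (h5 v (Finset.mem_univ v))).resolve_left (hw v).ne'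
  linarith

omit [Nonempty V] in
/-- A graph of index at most `c` containing a copy of a graph `H` with a positive `c`-harmonic
weight is isomorphic to `H`. -/
lemma nonempty_iso_of_hom_of_nbrSum_eq (hG : G.Connected) {W : Type*} [Fintype W] [Nonempty W]
    {H : SimpleGraph W} [DecidableRel H.Adj] {w : W → ℝ} (hw : ∀ i, 0 < w i) {c : ℝ}
    (h : ∀ i, nbrSum H w i = c * w i) (f : H →g G) (hf : Function.Injective f)
    (hc : (⨆ i, hA.eigenvalues i) ≤ c) : Nonempty (G ≃g H) := by
  classical
  set z : V → ℝ := Function.extend f w 0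
  have hzf : ∀ i, z (f i) = w i := fun i => hf.extend_apply _ _ _
  have hz0 : ∀ v, v ∉ Set.range f → z v = 0 := fun v hv =>
    Function.extend_apply' _ _ _ (by simpa using hv)
  have hsum : ∀ g : V → ℝ, (∀ v, v ∉ Set.range f → g v = 0) → ∑ v, g v = ∑ i, g (f i) :=
    fun g hg => (Fintype.sum_of_injective f hf (fun i => g (f i)) g hg fun _ => rfl).symm
  have hnonneg : ∀ v, 0 ≤ z v := fun v => by
    by_cases hv : v ∈ Set.range f
    · obtain ⟨i, rfl⟩ := hv
      rw [hzf]; exact (hw i).le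
    · rw [hz0 v hv]
  have hnbr : ∀ i, nbrSum G z (f i) = ∑ j, if G.Adj (f i) (f j) then w j else 0 := fun i => by
    rw [nbrSum, hsum _ fun v hv => by simp [hz0 v hv]]
    simp [hzf]
  have hle : ∀ i j, (if H.Adj i j then w j else 0) ≤ if G.Adj (f i) (f j) then w j else 0 :=
    fun i j => by
      by_cases hij : H.Adj i j
      · simp [hij, f.map_adj hij]
      · rw [if_neg hij]; split_ifs
        exacts [(hw j).le, le_rfl]
  have hge : ∀ i, c * w i ≤ nbrSum G z (f i) := fun i => by
    rw [hnbr, ← h]; exact Finset.sum_le_sum fun j _ => hle i j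
  have hsq : ∑ v, z v * z v = ∑ i, w i * w i := by
    rw [hsum _ fun v hv => by simp [hz0 v hv]]
    simp [hzf]
  have hsqpos : 0 < ∑ i, w i * w i :=
    Finset.sum_pos (fun v _ => mul_pos (hw v) (hw v)) Finset.univ_nonempty
  have hray : c * ∑ i, w i * w i ≤ ∑ v, z v * nbrSum G z v := by
    rw [hsum (fun v => z v * nbrSum G z v) fun v hv => by simp [hz0 v hv], Finset.mul_sum]
    refine Finset.sum_le_sum fun i _ => ?_
    rw [hzf]
    nlinarith [mul_le_mul_of_nonneg_left (hge i) (hw i).le]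
  have hup := sum_mul_nbrSum_le hA z
  rw [hsq] at hup
  have hceq : (⨆ i, hA.eigenvalues i) = c :=
    le_antisymm hc (le_of_mul_le_mul_right (hray.trans hup) hsqpos)
  have heig := nbrSum_eq_of_sum_mul_nbrSum_eq hA (x := z)
    (by rw [hsq]; exact le_antisymm hup (hceq ▸ hray))
  rw [hceq] at heig
  have hsurj : Function.Surjective f := fun v => by
    by_contra hv
    obtain ⟨i⟩ := ‹Nonempty W›
    have := eq_zero_of_nbrSum_le hG hnonneg (fun v => (heig v).le) (hz0 v hv) (f i)
    exact (hw i).ne' (by rw [← hzf, this])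
  have hadj : ∀ i j, G.Adj (f i) (f j) → H.Adj i j := fun i j hij => by
    by_contra hn
    have hlt : nbrSum H w i < nbrSum G z (f i) := by
      rw [hnbr]
      refine Finset.sum_lt_sum (fun j _ => hle i j) ⟨j, Finset.mem_univ _, ?_⟩
      simpa [hn, hij] using hw j
    rw [h, heig, hzf] at hlt
    exact lt_irrefl _ hlt
  exact ⟨(RelIso.mk (Equiv.ofBijective f ⟨hf, hsurj⟩) fun {i j} =>
    ⟨hadj i j, fun hij => f.map_adj hij⟩ : H ≃g G).symm⟩

end Spectral

section Weights

/-- A positive integral weight `w` with `A w = 2 w`. -/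
def IsNullWeight {W : Type*} [Fintype W] (H : SimpleGraph W) [DecidableRel H.Adj]
    (w : W → ℕ) : Prop :=
  ∀ i, 0 < w i ∧ nbrSum H w i = 2 * w i

/-- A positive integral weight `w` with `A w ≤ 2 w`, where the inequality is strict somewhere. -/
def IsDeficientWeight {W : Type*} [Fintype W] (H : SimpleGraph W) [DecidableRel H.Adj]
    (w : W → ℕ) : Prop :=
  (∀ i, 0 < w i ∧ nbrSum H w i ≤ 2 * w i) ∧ ∃ i, nbrSum H w i < 2 * w i

section Index

variable {V W : Type*} [Fintype V] [Fintype W] [DecidableEq V]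
  {G : SimpleGraph V} [DecidableRel G.Adj] (hA : (G.adjMatrix ℝ).IsHermitian)
  {H : SimpleGraph W} [DecidableRel H.Adj] {w : W → ℕ}

omit [DecidableEq V] in
lemma nbrSum_comp_iso (e : G ≃g H) (v : V) :
    nbrSum G (fun u => (w (e u) : ℝ)) v = ((nbrSum H w (e v) : ℕ) : ℝ) := by
  rw [natCast_nbrSum, nbrSum, nbrSum]
  exact Fintype.sum_equiv e.toEquiv _ _ fun u => by simp [e.map_adj_iff]

lemma IsNullWeight.index_eq_two [Nonempty V] (hw : IsNullWeight H w) (e : G ≃g H) :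
    (⨆ i, hA.eigenvalues i) = 2 :=
  index_eq_of_nbrSum_eq hA (w := fun v => (w (e v) : ℝ)) (fun v => by exact_mod_cast (hw (e v)).1)
    fun v => by rw [nbrSum_comp_iso, (hw (e v)).2]; push_cast; rfl

lemma IsDeficientWeight.index_lt_two [Nonempty V] (hG : G.Connected) (hw : IsDeficientWeight H w)
    (e : G ≃g H) : (⨆ i, hA.eigenvalues i) < 2 := by
  obtain ⟨i, hi⟩ := hw.2
  refine index_lt_of_nbrSum_lt hA hG (w := fun v => (w (e v) : ℝ))
    (fun v => by exact_mod_cast (hw.1 (e v)).1) (fun v => ?_) (a := e.symm i) ?_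
  · rw [nbrSum_comp_iso]; exact_mod_cast (hw.1 (e v)).2
  · rw [nbrSum_comp_iso, e.apply_symm_apply]; exact_mod_cast hi

lemma IsNullWeight.nonempty_iso [Nonempty W] (hG : G.Connected) (hw : IsNullWeight H w)
    (hc : (⨆ i, hA.eigenvalues i) ≤ 2) (f : H →g G) (hf : Function.Injective f) :
    Nonempty (G ≃g H) :=
  nonempty_iso_of_hom_of_nbrSum_eq hA hG (w := fun i => (w i : ℝ))
    (fun i => by exact_mod_cast (hw i).1)
    (fun i => by rw [← natCast_nbrSum, (hw i).2]; push_cast; rfl) f hf hc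

omit [DecidableEq V] in
lemma nbrSum_eq_sum {v : V} {s : Finset V} (x : V → ℕ) (h : ∀ u, G.Adj v u ↔ u ∈ s) :
    nbrSum G x v = ∑ u ∈ s, x u := by
  rw [nbrSum, ← Finset.sum_filter]
  exact Finset.sum_congr (by ext u; simp [h]) fun _ _ => rfl

omit [DecidableEq V] in
lemma nbrSum_le_sum {v : V} {s : Finset V} (x : V → ℕ) (h : ∀ u, G.Adj v u → u ∈ s) :
    nbrSum G x v ≤ ∑ u ∈ s, x u := by
  rw [nbrSum, ← Finset.sum_filter]
  exact Finset.sum_le_sum_of_subset fun u hu => h u (Finset.mem_filter.1 hu).2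

lemma sum_attachFin {n : ℕ} {s : Finset ℕ} (hs : ∀ j ∈ s, j < n) (g : ℕ → ℕ) :
    ∑ j ∈ s.attachFin hs, g j = ∑ j ∈ s, g j := by
  conv_rhs => rw [← Finset.map_valEmbedding_attachFin hs, Finset.sum_map]
  rfl

lemma nbrSum_fin_eq_sum {n : ℕ} {H : SimpleGraph (Fin n)} [DecidableRel H.Adj] {i : Fin n}
    (g : ℕ → ℕ) (s : Finset ℕ) (hs : ∀ j ∈ s, j < n)
    (h : ∀ j (hj : j < n), H.Adj i ⟨j, hj⟩ ↔ j ∈ s) :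
    nbrSum H (fun j => g j) i = ∑ j ∈ s, g j := by
  rw [nbrSum_eq_sum (s := s.attachFin hs) _ fun j => by simpa using h j.1 j.2, sum_attachFin hs]

lemma nbrSum_fin_le_sum {n : ℕ} {H : SimpleGraph (Fin n)} [DecidableRel H.Adj] {i : Fin n}
    (g : ℕ → ℕ) (s : Finset ℕ) (hs : ∀ j ∈ s, j < n)
    (h : ∀ j (hj : j < n), H.Adj i ⟨j, hj⟩ → j ∈ s) :
    nbrSum H (fun j => g j) i ≤ ∑ j ∈ s, g j := by
  rw [← sum_attachFin hs]
  exact nbrSum_le_sum _ fun j hj => by simpa using h j.1 j.2 hj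

end Index

instance (m : ℕ) : DecidableRel (dynkinD m).Adj := by unfold dynkinD; infer_instance
instance (m : ℕ) : DecidableRel (dynkinE m).Adj := by unfold dynkinE; infer_instance
instance (m : ℕ) : DecidableRel (extDynkinD m).Adj := by unfold extDynkinD; infer_instance
instance : DecidableRel extDynkinE6.Adj := by unfold extDynkinE6; infer_instance
instance : DecidableRel extDynkinE7.Adj := by unfold extDynkinE7; infer_instance
instance : DecidableRel extDynkinE8.Adj := by unfold extDynkinE8; infer_instance

lemma isNullWeight_extDynkinE6 : IsNullWeight extDynkinE6 ![1, 2, 3, 2, 1, 2, 1] := by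
  unfold IsNullWeight; decide

lemma isNullWeight_extDynkinE7 : IsNullWeight extDynkinE7 ![1, 2, 3, 4, 3, 2, 1, 2] := by
  unfold IsNullWeight; decide

lemma isNullWeight_extDynkinE8 : IsNullWeight extDynkinE8 ![2, 4, 6, 5, 4, 3, 2, 1, 3] := by
  unfold IsNullWeight; decide

lemma isDeficientWeight_dynkinE6 : IsDeficientWeight (dynkinE 6) ![1, 2, 3, 2, 1, 2] := by
  unfold IsDeficientWeight; decide

lemma isDeficientWeight_dynkinE7 : IsDeficientWeight (dynkinE 7) ![2, 3, 4, 3, 2, 1, 2] := by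
  unfold IsDeficientWeight; decide

lemma isDeficientWeight_dynkinE8 : IsDeficientWeight (dynkinE 8) ![2, 4, 6, 5, 4, 3, 2, 3] := by
  unfold IsDeficientWeight; decide

lemma isNullWeight_cycleGraph (n : ℕ) : IsNullWeight (cycleGraph (n + 3)) fun _ => 1 := fun i =>
  ⟨one_pos, by
    rw [nbrSum_eq_sum (s := (cycleGraph (n + 3)).neighborFinset i) _ (by simp),
      Finset.sum_const, card_neighborFinset_eq_degree, cycleGraph_degree_three_le]
    rfl⟩

lemma extDynkinD_adj_mk {m i j : ℕ} (hi : i < m + 1) (hj : j < m + 1) :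
    (extDynkinD m).Adj ⟨i, hi⟩ ⟨j, hj⟩ ↔ i ≠ j ∧
      (((2 ≤ i ∧ i + 1 = j ∧ j ≤ m - 2) ∨ (i ≤ 1 ∧ j = 2) ∨ (i = m - 2 ∧ (j = m - 1 ∨ j = m))) ∨
      ((2 ≤ j ∧ j + 1 = i ∧ i ≤ m - 2) ∨ (j ≤ 1 ∧ i = 2) ∨
        (j = m - 2 ∧ (i = m - 1 ∨ i = m)))) := by
  simp [extDynkinD]

lemma dynkinD_adj_mk {m i j : ℕ} (hi : i < m) (hj : j < m) :
    (dynkinD m).Adj ⟨i, hi⟩ ⟨j, hj⟩ ↔ i ≠ j ∧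
      (((1 ≤ i ∧ i + 1 = j) ∨ (i = 0 ∧ j = 2)) ∨ ((1 ≤ j ∧ j + 1 = i) ∨ (j = 0 ∧ i = 2))) := by
  simp [dynkinD]

lemma isNullWeight_extDynkinD {m : ℕ} (hm : 4 ≤ m) : IsNullWeight (extDynkinD m)
    fun i => if i.val ≤ 1 ∨ m - 1 ≤ i.val then 1 else 2 := by
  rintro ⟨i, hi⟩
  refine ⟨by dsimp only; split_ifs <;> simp, ?_⟩
  have key := nbrSum_fin_eq_sum (H := extDynkinD m) (i := ⟨i, hi⟩)
    fun j => if j ≤ 1 ∨ m - 1 ≤ j then 1 else 2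
  simp only [extDynkinD_adj_mk] at key
  by_cases h1 : i ≤ 1
  · rw [key {2}
      (by simp only [Finset.mem_singleton, forall_eq]; omega)
      (by simp only [Finset.mem_singleton]; omega),
      Finset.sum_singleton]
    grind
  by_cases h2 : m - 1 ≤ i
  · rw [key {m - 2}
      (by simp only [Finset.mem_singleton, forall_eq]; omega)
      (by simp only [Finset.mem_singleton]; omega),
      Finset.sum_singleton]
    grind
  by_cases h3 : m = 4
  · rw [key {0, 1, 3, 4}
      (by simp only [Finset.mem_insert, Finset.mem_singleton, forall_eq_or_imp, forall_eq]; omega)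
      (by simp only [Finset.mem_insert, Finset.mem_singleton]; omega),
      Finset.sum_insert (by simp only [Finset.mem_insert, Finset.mem_singleton]; omega),
      Finset.sum_insert (by simp only [Finset.mem_insert, Finset.mem_singleton]; omega),
      Finset.sum_insert (by simp only [Finset.mem_singleton]; omega),
      Finset.sum_singleton]
    grind
  by_cases h4 : i = 2
  · rw [key {0, 1, 3}
      (by simp only [Finset.mem_insert, Finset.mem_singleton, forall_eq_or_imp, forall_eq]; omega)
      (by simp only [Finset.mem_insert, Finset.mem_singleton]; omega),
      Finset.sum_insert (by simp only [Finset.mem_insert, Finset.mem_singleton]; omega),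
      Finset.sum_insert (by simp only [Finset.mem_singleton]; omega),
      Finset.sum_singleton]
    grind
  by_cases h5 : i = m - 2
  · rw [key {m - 3, m - 1, m}
      (by simp only [Finset.mem_insert, Finset.mem_singleton, forall_eq_or_imp, forall_eq]; omega)
      (by simp only [Finset.mem_insert, Finset.mem_singleton]; omega),
      Finset.sum_insert (by simp only [Finset.mem_insert, Finset.mem_singleton]; omega),
      Finset.sum_insert (by simp only [Finset.mem_singleton]; omega),
      Finset.sum_singleton]
    grind
  · rw [key {i - 1, i + 1}
      (by simp only [Finset.mem_insert, Finset.mem_singleton, forall_eq_or_imp, forall_eq]; omega)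
      (by simp only [Finset.mem_insert, Finset.mem_singleton]; omega),
      Finset.sum_insert (by simp only [Finset.mem_singleton]; omega),
      Finset.sum_singleton]
    grind

lemma isDeficientWeight_dynkinD {m : ℕ} (hm : 4 ≤ m) : IsDeficientWeight (dynkinD m)
    fun i => if i.val ≤ 1 then 1 else 2 := by
  have key := fun i hi => nbrSum_fin_le_sum (H := dynkinD m) (i := ⟨i, hi⟩)
    fun j => if j ≤ 1 then 1 else 2
  simp only [dynkinD_adj_mk] at key
  refine ⟨fun ⟨i, hi⟩ => ⟨by dsimp only; split_ifs <;> simp, ?_⟩, ⟨m - 1, by omega⟩, ?_⟩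
  · replace key := key i hi
    by_cases h1 : i ≤ 1
    · refine (key {2}
        (by simp only [Finset.mem_singleton, forall_eq]; omega)
        (by simp only [Finset.mem_singleton]; omega)).trans ?_
      rw [Finset.sum_singleton]
      grind
    by_cases h2 : i = 2
    · refine (key {0, 1, 3}
        (by simp only [Finset.mem_insert, Finset.mem_singleton, forall_eq_or_imp, forall_eq]; omega)
        (by simp only [Finset.mem_insert, Finset.mem_singleton]; omega)).trans ?_
      rw [Finset.sum_insert (by simp only [Finset.mem_insert, Finset.mem_singleton]; omega),
        Finset.sum_insert (by simp only [Finset.mem_singleton]; omega),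
        Finset.sum_singleton]
      grind
    by_cases h3 : i = m - 1
    · refine (key {m - 2}
        (by simp only [Finset.mem_singleton, forall_eq]; omega)
        (by simp only [Finset.mem_singleton]; omega)).trans ?_
      rw [Finset.sum_singleton]
      grind
    · refine (key {i - 1, i + 1}
        (by simp only [Finset.mem_insert, Finset.mem_singleton, forall_eq_or_imp, forall_eq]; omega)
        (by simp only [Finset.mem_insert, Finset.mem_singleton]; omega)).trans ?_
      rw [Finset.sum_insert (by simp only [Finset.mem_singleton]; omega),
        Finset.sum_singleton]
      grind
  · replace key := key (m - 1) (by omega)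
    refine (key {m - 2}
      (by simp only [Finset.mem_singleton, forall_eq]; omega)
      (by simp only [Finset.mem_singleton]; omega)).trans_lt ?_
    rw [Finset.sum_singleton]
    grind

instance (n : ℕ) : DecidableRel (pathGraph n).Adj := fun _ _ =>
  decidable_of_iff' _ pathGraph_adj

lemma isDeficientWeight_pathGraph {n : ℕ} (hn : 1 ≤ n) :
    IsDeficientWeight (pathGraph n) fun _ => 1 := by
  have key := fun i hi => nbrSum_fin_le_sum (H := pathGraph n) (i := ⟨i, hi⟩) fun _ => 1
  simp only [pathGraph_adj, Finset.sum_const, smul_eq_mul, mul_one] at key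
  refine ⟨fun ⟨i, hi⟩ => ⟨one_pos, ?_⟩, ⟨0, hn⟩, ?_⟩
  · by_cases h1 : i + 1 < n
    · exact (key i hi {i - 1, i + 1}
        (by simp only [Finset.mem_insert, Finset.mem_singleton, forall_eq_or_imp, forall_eq]; omega)
        (by simp only [Finset.mem_insert, Finset.mem_singleton]; omega)).trans
        Finset.card_le_two
    · exact (key i hi {i - 1}
        (by simp only [Finset.mem_singleton, forall_eq]; omega)
        (by simp only [Finset.mem_singleton]; omega)).trans (by simp)
  · by_cases h1 : 1 < n
    · exact (key 0 hn {1} (by simp only [Finset.mem_singleton, forall_eq]; omega)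
        (by simp only [Finset.mem_singleton]; omega)).trans_lt (by simp)
    · exact (key 0 hn ∅ (by simp) (by simp only [Finset.notMem_empty]; omega)).trans_lt (by simp)

end Weights

section Classification

lemma SimpleGraph.connected_of_exists_adj_lt {W : Type*} {H : SimpleGraph W} (μ : W → ℕ) (r : W)
    (h : ∀ x, x ≠ r → ∃ y, H.Adj x y ∧ μ y < μ x) : H.Connected := by
  have key : ∀ n x, μ x = n → H.Reachable x r := fun n => by
    induction n using Nat.strong_induction_on with
    | _ n ih =>
      intro x hx
      by_cases hxr : x = r
      · rw [hxr]
      · obtain ⟨y, hxy, hy⟩ := h x hxr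
        exact hxy.reachable.trans (ih _ (hx ▸ hy) y rfl)
  exact (connected_iff_exists_forall_reachable H).2 ⟨r, fun x => (key _ x rfl).symm⟩

lemma connected_dynkinD {m : ℕ} (hm : 4 ≤ m) : (dynkinD m).Connected := by
  refine connected_of_exists_adj_lt (fun i => m - i.val) ⟨m - 1, by omega⟩ fun ⟨i, hi⟩ hne => ?_
  simp only [ne_eq, Fin.mk.injEq] at hne
  by_cases h0 : i = 0
  · exact ⟨⟨2, by omega⟩, (dynkinD_adj_mk _ _).2 (by omega), by simp only; omega⟩
  · exact ⟨⟨i + 1, by omega⟩, (dynkinD_adj_mk _ _).2 (by omega), by simp only; omega⟩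

lemma connected_dynkinE6 : (dynkinE 6).Connected :=
  connected_of_exists_adj_lt Fin.val 0 (by decide)

lemma connected_dynkinE7 : (dynkinE 7).Connected :=
  connected_of_exists_adj_lt Fin.val 0 (by decide)

lemma connected_dynkinE8 : (dynkinE 8).Connected :=
  connected_of_exists_adj_lt Fin.val 0 (by decide)

variable {V : Type*} {G : SimpleGraph V}

lemma SimpleGraph.IsAcyclic.nonempty_iso_of_bijective_hom {W : Type*} {H : SimpleGraph W}
    (hG : G.IsAcyclic) (hH : H.Connected) (f : H →g G) (hf : Function.Bijective f) :
    Nonempty (G ≃g H) := by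
  let e := Equiv.ofBijective f hf
  have hadj : ∀ i j, G.Adj (f i) (f j) → H.Adj i j := fun i j hij => by
    by_contra hn
    have hb := (isBridge_iff.1 (isAcyclic_iff_forall_adj_isBridge.1 hG hij))
    let g : H →g G.deleteEdges {s(f i, f j)} := ⟨f, fun {a b} hab => by
      rw [deleteEdges_adj]
      refine ⟨f.map_adj hab, fun hs => hn ?_⟩
      rw [Set.mem_singleton_iff, Sym2.eq_iff, hf.1.eq_iff, hf.1.eq_iff, hf.1.eq_iff,
        hf.1.eq_iff] at hs
      obtain ⟨rfl, rfl⟩ | ⟨rfl, rfl⟩ := hs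
      exacts [hab, hab.symm]⟩
    exact hb ((hH.preconnected i j).map g)
  exact ⟨(RelIso.mk e fun {i j} => ⟨hadj i j, fun hij => f.map_adj hij⟩ : H ≃g G).symm⟩

lemma SimpleGraph.fromRel_map_adj {W : Type*} {r : W → W → Prop} {f : W → V}
    (h : ∀ i j, r i j → G.Adj (f i) (f j)) {i j : W} (hij : (fromRel r).Adj i j) :
    G.Adj (f i) (f j) :=
  hij.2.elim (h i j) fun hr => (h j i hr).symm

variable (G) in
/-- `G` is isomorphic to one of the Dynkin graphs. -/
def IsDynkin : Prop :=
  (∃ n : ℕ, 1 ≤ n ∧ Nonempty (G ≃g pathGraph n)) ∨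
  (∃ n : ℕ, 4 ≤ n ∧ Nonempty (G ≃g dynkinD n)) ∨
  Nonempty (G ≃g dynkinE 6) ∨ Nonempty (G ≃g dynkinE 7) ∨ Nonempty (G ≃g dynkinE 8)

variable (G) in
/-- `G` is isomorphic to one of the extended Dynkin graphs. -/
def IsExtDynkin : Prop :=
  (∃ n : ℕ, 3 ≤ n ∧ Nonempty (G ≃g cycleGraph n)) ∨
  (∃ n : ℕ, 4 ≤ n ∧ Nonempty (G ≃g extDynkinD n)) ∨
  Nonempty (G ≃g extDynkinE6) ∨ Nonempty (G ≃g extDynkinE7) ∨ Nonempty (G ≃g extDynkinE8)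

variable (G) in
/-- `G` contains a copy of an extended Dynkin tree. -/
def ContainsExtDynkinTree : Prop :=
  (∃ n : ℕ, 4 ≤ n ∧ extDynkinD n ⊑ G) ∨ extDynkinE6 ⊑ G ∨ extDynkinE7 ⊑ G ∨ extDynkinE8 ⊑ G

/-- The vertices `v 0, …, v n` form a path of length `n` in `G`. -/
structure IsPathSeq (G : SimpleGraph V) (n : ℕ) (v : ℕ → V) : Prop where
  adj : ∀ i < n, G.Adj (v i) (v (i + 1))
  inj : ∀ i ≤ n, ∀ j ≤ n, v i = v j → i = j

namespace IsPathSeq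

variable {n : ℕ} {v : ℕ → V}

lemma exists_maximal [Finite V] [Nonempty V] (G : SimpleGraph V) :
    ∃ n v, IsPathSeq G n v ∧ ∀ n' v', IsPathSeq G n' v' → n' ≤ n := by
  have := Fintype.ofFinite V
  have hb : ∀ n v, IsPathSeq G n v → n ≤ Fintype.card V := fun n v h => by
    have := Fintype.card_le_of_injective (fun i : Fin (n + 1) => v i) fun i j hij =>
      Fin.ext (h.inj _ (by omega) _ (by omega) hij)
    rw [Fintype.card_fin] at this
    omega
  obtain ⟨a⟩ := ‹Nonempty V›
  have h0 : ∃ v, IsPathSeq G 0 v := ⟨fun _ => a, by omega, by omega⟩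
  classical
  obtain ⟨v, hv⟩ := Nat.findGreatest_spec (P := fun n => ∃ v, IsPathSeq G n v)
    (Nat.zero_le (Fintype.card V)) h0
  exact ⟨_, v, hv, fun n' v' h' => Nat.le_findGreatest (hb _ _ h') ⟨v', h'⟩⟩

lemma reverse (h : IsPathSeq G n v) : IsPathSeq G n fun k => v (n - k) where
  adj i hi := by
    have := h.adj (n - (i + 1)) (by omega)
    rw [show n - (i + 1) + 1 = n - i by omega] at this
    exact this.symm
  inj i hi j hj hij := by
    have := h.inj _ (by omega) _ (by omega) hij
    omega

lemma cons (h : IsPathSeq G n v) {u : V} (hu : ∀ k ≤ n, v k ≠ u) (hadj : G.Adj u (v 0)) :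
    IsPathSeq G (n + 1) fun k => if k = 0 then u else v (k - 1) where
  adj i hi := by
    rcases i with _ | i
    · simpa using hadj
    · simpa using h.adj i (by omega)
  inj i hi j hj hij := by
    rcases i with _ | i <;> rcases j with _ | j
    · rfl
    · exact absurd (by simpa using hij.symm) (hu j (by omega))
    · exact absurd (by simpa using hij) (hu i (by omega))
    · simpa using h.inj i (by omega) j (by omega) (by simpa using hij)

lemma tail (h : IsPathSeq G (n + 1) v) : IsPathSeq G n fun k => v (k + 1) where
  adj i hi := h.adj _ (by omega)
  inj i hi j hj hij := by simpa using h.inj _ (by omega) _ (by omega) hij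

section Maximal

variable (h : IsPathSeq G n v) (hmax : ∀ n' v', IsPathSeq G n' v' → n' ≤ n) {u : V}
  (hu : ∀ k ≤ n, v k ≠ u)

include h hmax hu

lemma not_adj_zero : ¬ G.Adj u (v 0) := fun hadj => by
  have := hmax _ _ (h.cons hu hadj)
  omega

lemma pos_and_lt_of_adj {i : ℕ} (hi : i ≤ n) (hadj : G.Adj u (v i)) : 0 < i ∧ i < n := by
  constructor
  · rcases Nat.eq_zero_or_pos i with rfl | hpos
    exacts [absurd hadj (h.not_adj_zero hmax hu), hpos]
  · rcases hi.eq_or_lt with rfl | hlt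
    · exact absurd (by simpa using hadj)
        (h.reverse.not_adj_zero hmax fun k _ => hu _ (by omega))
    · exact hlt

end Maximal

lemma nonempty_iso_pathGraph (h : IsPathSeq G n v) (hG : G.IsAcyclic)
    (hsurj : ∀ x, ∃ k ≤ n, v k = x) : Nonempty (G ≃g pathGraph (n + 1)) := by
  refine hG.nonempty_iso_of_bijective_hom (pathGraph_connected n)
    ⟨fun k => v k, fun {i j} hij => ?_⟩ ⟨fun i j hij => ?_, fun x => ?_⟩
  · rw [pathGraph_adj] at hij
    rcases hij with hij | hij
    · rw [← hij]; exact h.adj _ (by omega)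
    · rw [← hij]; exact (h.adj _ (by omega)).symm
  · exact Fin.ext (h.inj _ (by omega) _ (by omega) hij)
  · obtain ⟨k, hk, rfl⟩ := hsurj x
    exact ⟨⟨k, by omega⟩, rfl⟩

variable {u w : V}

section OffPath

variable (h : IsPathSeq G n v) (hu : ∀ k ≤ n, v k ≠ u)

include h hu

lemma extDynkinD_isContained (hw : ∀ k ≤ n, v k ≠ w) (huw : u ≠ w) {i j : ℕ} (hi : 0 < i)
    (hij : i ≤ j) (hj : j < n) (hui : G.Adj u (v i)) (hwj : G.Adj w (v j)) :
    extDynkinD (j - i + 4) ⊑ G := by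
  obtain ⟨i, rfl⟩ : ∃ i', i = i' + 1 := ⟨i - 1, by omega⟩
  obtain ⟨d, rfl⟩ := Nat.exists_eq_add_of_le hij
  rw [show i + 1 + d - (i + 1) + 4 = d + 4 by omega]
  let f : ℕ → V := fun k => if k = 0 then u else if k = d + 4 then w else v (i + k - 1)
  refine ⟨Hom.toCopy ⟨fun k : Fin (d + 4 + 1) => f k, fun {a b} hab => ?_⟩ ?_⟩
  · refine fromRel_map_adj (f := fun k : Fin (d + 4 + 1) => f k) ?_ hab
    rintro ⟨a, ha⟩ ⟨b, hb⟩ hr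
    simp only [f] at hr ⊢
    have hadj := h.adj (i + a - 1)
    have hadj' := hwj.symm
    grind
  · rintro ⟨a, ha⟩ ⟨b, hb⟩ hab
    simp only [f, RelHom.coeFn_mk] at hab
    have h1 := h.inj (i + a - 1)
    grind

lemma extDynkinE6_isContained (hw : ∀ k ≤ n, v k ≠ w) {i : ℕ} (hi : 2 ≤ i) (hin : i + 2 ≤ n)
    (hui : G.Adj u (v i)) (hwu : G.Adj w u) : extDynkinE6 ⊑ G := by
  obtain ⟨i, rfl⟩ := Nat.exists_eq_add_of_le' hi
  let f : ℕ → V := fun k => if k ≤ 4 then v (i + k) else if k = 5 then u else w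
  refine ⟨Hom.toCopy ⟨fun k : Fin 7 => f k, fun {a b} hab => ?_⟩ ?_⟩
  · refine fromRel_map_adj (f := fun k : Fin 7 => f k) ?_ hab
    rintro ⟨a, ha⟩ ⟨b, hb⟩ hr
    simp only [f] at hr ⊢
    have hadj := h.adj (i + a)
    have hadj' := hui.symm
    have hadj'' := hwu.symm
    grind
  · rintro ⟨a, ha⟩ ⟨b, hb⟩ hab
    simp only [f, RelHom.coeFn_mk] at hab
    have h1 := h.inj (i + a)
    have h2 := hwu.ne
    grind

lemma extDynkinE7_isContained {i : ℕ} (hi : 3 ≤ i) (hin : i + 3 ≤ n)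
    (hui : G.Adj u (v i)) : extDynkinE7 ⊑ G := by
  obtain ⟨i, rfl⟩ := Nat.exists_eq_add_of_le' hi
  let f : ℕ → V := fun k => if k ≤ 6 then v (i + k) else u
  refine ⟨Hom.toCopy ⟨fun k : Fin 8 => f k, fun {a b} hab => ?_⟩ ?_⟩
  · refine fromRel_map_adj (f := fun k : Fin 8 => f k) ?_ hab
    rintro ⟨a, ha⟩ ⟨b, hb⟩ hr
    simp only [f] at hr ⊢
    have hadj := h.adj (i + a)
    have hadj' := hui.symm
    grind
  · rintro ⟨a, ha⟩ ⟨b, hb⟩ hab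
    simp only [f, RelHom.coeFn_mk] at hab
    have h1 := h.inj (i + a)
    grind

lemma extDynkinE8_isContained (hn : 7 ≤ n) (hu2 : G.Adj u (v 2)) : extDynkinE8 ⊑ G := by
  let f : ℕ → V := fun k => if k ≤ 7 then v k else u
  refine ⟨Hom.toCopy ⟨fun k : Fin 9 => f k, fun {a b} hab => ?_⟩ ?_⟩
  · refine fromRel_map_adj (f := fun k : Fin 9 => f k) ?_ hab
    rintro ⟨a, ha⟩ ⟨b, hb⟩ hr
    simp only [f] at hr ⊢
    have hadj := h.adj a
    have hadj' := hu2.symm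
    grind
  · rintro ⟨a, ha⟩ ⟨b, hb⟩ hab
    simp only [f, RelHom.coeFn_mk] at hab
    have h1 := h.inj a
    grind

lemma nonempty_iso_dynkinD (hG : G.IsAcyclic) (hsurj : ∀ x ≠ u, ∃ k ≤ n, v k = x) (hn : 2 ≤ n)
    (hu1 : G.Adj u (v 1)) : Nonempty (G ≃g dynkinD (n + 2)) := by
  let f : ℕ → V := fun k => if k = 0 then u else v (k - 1)
  refine hG.nonempty_iso_of_bijective_hom (connected_dynkinD (by omega))
    ⟨fun k => f k, fun {a b} hab => ?_⟩ ⟨?_, fun x => ?_⟩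
  · refine fromRel_map_adj (f := fun k : Fin (n + 2) => f k) ?_ hab
    rintro ⟨a, ha⟩ ⟨b, hb⟩ hr
    simp only [f] at hr ⊢
    have hadj := h.adj (a - 1)
    grind
  · rintro ⟨a, ha⟩ ⟨b, hb⟩ hab
    simp only [f, RelHom.coeFn_mk] at hab
    have h1 := h.inj (a - 1)
    grind
  · by_cases hx : x = u
    · exact ⟨0, by simp [f, hx]⟩
    · obtain ⟨k, hk, rfl⟩ := hsurj x hx
      exact ⟨⟨k + 1, by omega⟩, by simp [f]⟩

lemma nonempty_iso_dynkinE (hG : G.IsAcyclic) (hsurj : ∀ x ≠ u, ∃ k ≤ n, v k = x) (hn : 2 ≤ n)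
    (hconn : (dynkinE (n + 2)).Connected) (hu2 : G.Adj u (v 2)) :
    Nonempty (G ≃g dynkinE (n + 2)) := by
  let f : ℕ → V := fun k => if k ≤ n then v k else u
  refine hG.nonempty_iso_of_bijective_hom hconn
    ⟨fun k => f k, fun {a b} hab => ?_⟩ ⟨?_, fun x => ?_⟩
  · refine fromRel_map_adj (f := fun k : Fin (n + 2) => f k) ?_ hab
    rintro ⟨a, ha⟩ ⟨b, hb⟩ hr
    simp only [f] at hr ⊢
    have hadj := h.adj a
    have hadj' := hu2.symm
    grind
  · rintro ⟨a, ha⟩ ⟨b, hb⟩ hab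
    simp only [f, RelHom.coeFn_mk] at hab
    have h1 := h.inj a
    grind
  · by_cases hx : x = u
    · exact ⟨⟨n + 1, by omega⟩, by simp [f, hx]⟩
    · obtain ⟨k, hk, rfl⟩ := hsurj x hx
      exact ⟨⟨k, by omega⟩, by simp [f, hk]⟩

end OffPath

/-- A maximal path in a tree with a vertex hanging off it forces one of the Dynkin graphs with a
branch vertex, or a copy of an extended Dynkin graph. -/
lemma isDynkin_or_isContained_of_branch (h : IsPathSeq G n v)
    (hmax : ∀ n' v', IsPathSeq G n' v' → n' ≤ n) (hu : ∀ k ≤ n, v k ≠ u)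
    (hG : G.Connected) (hG' : G.IsAcyclic) {i : ℕ} (hin : 2 * i ≤ n) (hui : G.Adj u (v i)) :
    IsDynkin G ∨ ContainsExtDynkinTree G := by
  obtain ⟨hi, hi'⟩ := h.pos_and_lt_of_adj hmax hu (by omega) hui
  by_cases hsurj : ∀ x, (∃ k ≤ n, v k = x) ∨ x = u
  · replace hsurj : ∀ x ≠ u, ∃ k ≤ n, v k = x := fun x hx => (hsurj x).resolve_right hx
    rcases (by omega : i = 1 ∨ i = 2 ∨ 3 ≤ i) with rfl | rfl | hi3
    · exact .inl <| .inr <| .inl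
        ⟨n + 2, by omega, h.nonempty_iso_dynkinD hu hG' hsurj (by omega) hui⟩
    · rcases (by omega : n = 4 ∨ n = 5 ∨ n = 6 ∨ 7 ≤ n) with rfl | rfl | rfl | hn
      · exact .inl <| .inr <| .inr <| .inl <|
          h.nonempty_iso_dynkinE hu hG' hsurj (by omega) connected_dynkinE6 hui
      · exact .inl <| .inr <| .inr <| .inr <| .inl <|
          h.nonempty_iso_dynkinE hu hG' hsurj (by omega) connected_dynkinE7 hui
      · exact .inl <| .inr <| .inr <| .inr <| .inr <|
          h.nonempty_iso_dynkinE hu hG' hsurj (by omega) connected_dynkinE8 hui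
      · exact .inr <| .inr <| .inr <| .inr <| h.extDynkinE8_isContained hu hn hui
    · exact .inr <| .inr <| .inr <| .inl <|
        h.extDynkinE7_isContained hu hi3 (by omega) hui
  · obtain ⟨x, y, hx, hxy, hy⟩ : ∃ x y, ((∃ k ≤ n, v k = x) ∨ x = u) ∧ G.Adj x y ∧
        ¬ ((∃ k ≤ n, v k = y) ∨ y = u) := by
      by_contra! hcl
      exact hsurj fun x => hG.forall_of_adj (P := fun x => (∃ k ≤ n, v k = x) ∨ x = u)
        (.inr rfl) (fun x y hx hxy => by simpa using hcl x y hx hxy) x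
    push Not at hy
    obtain ⟨hyv, hyu⟩ := hy
    right
    rcases hx with ⟨j, hj, rfl⟩ | rfl
    · obtain ⟨hj0, hjn⟩ := h.pos_and_lt_of_adj hmax hyv hj hxy.symm
      left
      rcases le_total i j with hij | hij
      · exact ⟨_, by omega, h.extDynkinD_isContained hu hyv hyu.symm hi hij hjn hui hxy.symm⟩
      · exact ⟨_, by omega, h.extDynkinD_isContained hyv hu hyu hj0 hij hi' hxy.symm hui⟩
    · rcases (by omega : i = 1 ∨ 2 ≤ i) with rfl | hi2
      · obtain ⟨n, rfl⟩ := Nat.exists_eq_add_of_le' hi'.le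
        have h' := (h.tail.cons (u := x) (fun k hk => hu _ (by omega)) hui).cons (u := y)
          (by grind) (by simpa using hxy.symm)
        have := hmax _ _ h'
        omega
      · exact .inr <| .inl <| h.extDynkinE6_isContained hu hyv hi2 (by omega) hui hxy.symm

end IsPathSeq

lemma SimpleGraph.IsAcyclic.isDynkin_or_containsExtDynkinTree [Finite V] (hG : G.Connected)
    (hG' : G.IsAcyclic) : IsDynkin G ∨ ContainsExtDynkinTree G := by
  have := hG.nonempty
  obtain ⟨n, v, h, hmax⟩ := IsPathSeq.exists_maximal G
  by_cases hsurj : ∀ x, ∃ k ≤ n, v k = x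
  · exact .inl <| .inl ⟨n + 1, by omega, h.nonempty_iso_pathGraph hG' hsurj⟩
  · obtain ⟨x, u, ⟨i, hi, rfl⟩, hadj, hu⟩ :
        ∃ x u, (∃ k ≤ n, v k = x) ∧ G.Adj x u ∧ ¬ ∃ k ≤ n, v k = u := by
      by_contra! hcl
      exact hsurj fun x => hG.forall_of_adj (P := fun x => ∃ k ≤ n, v k = x)
        (a := v 0) ⟨0, by omega, rfl⟩ (fun x y hx hxy => by simpa using hcl x y hx hxy) x
    push Not at hu
    rcases le_total (2 * i) n with hin | hin
    · exact h.isDynkin_or_isContained_of_branch hmax hu hG hG' hin hadj.symm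
    · refine h.reverse.isDynkin_or_isContained_of_branch hmax (fun k _ => hu _ (by omega)) hG hG'
        (i := n - i) (by omega) ?_
      rw [Nat.sub_sub_self hi]
      exact hadj.symm

end Classification

lemma isDynkin_or_isExtDynkin_of_index_le_two {V : Type*} [Fintype V] [DecidableEq V] [Nonempty V]
    {G : SimpleGraph V} [DecidableRel G.Adj] (hA : (G.adjMatrix ℝ).IsHermitian)
    (hG : G.Connected) (hle : (⨆ i, hA.eigenvalues i) ≤ 2) : IsDynkin G ∨ IsExtDynkin G := by
  by_cases hG' : G.IsAcyclic
  · refine (hG'.isDynkin_or_containsExtDynkinTree hG).imp_right ?_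
    rintro (⟨m, hm, ⟨f⟩⟩ | ⟨⟨f⟩⟩ | ⟨⟨f⟩⟩ | ⟨⟨f⟩⟩)
    · exact .inr <| .inl
        ⟨m, hm, (isNullWeight_extDynkinD hm).nonempty_iso hA hG hle f.toHom f.injective⟩
    · exact .inr <| .inr <| .inl <|
        isNullWeight_extDynkinE6.nonempty_iso hA hG hle f.toHom f.injective
    · exact .inr <| .inr <| .inr <| .inl <|
        isNullWeight_extDynkinE7.nonempty_iso hA hG hle f.toHom f.injective
    · exact .inr <| .inr <| .inr <| .inr <|
        isNullWeight_extDynkinE8.nonempty_iso hA hG hle f.toHom f.injective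
  · rw [isAcyclic_iff_free_cycleGraph] at hG'
    push Not at hG'
    obtain ⟨n, hn, hf⟩ := hG'
    obtain ⟨n, rfl⟩ := Nat.exists_eq_add_of_le' hn
    obtain ⟨f⟩ := hf
    exact .inr <| .inl
      ⟨n + 3, hn, (isNullWeight_cycleGraph n).nonempty_iso hA hG hle f.toHom f.injective⟩

lemma IsDynkin.index_lt_two {V : Type*} [Fintype V] [DecidableEq V] [Nonempty V]
    {G : SimpleGraph V} [DecidableRel G.Adj] (hA : (G.adjMatrix ℝ).IsHermitian)
    (hG : G.Connected) (h : IsDynkin G) : (⨆ i, hA.eigenvalues i) < 2 := by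
  obtain ⟨n, hn, ⟨e⟩⟩ | ⟨n, hn, ⟨e⟩⟩ | ⟨⟨e⟩⟩ | ⟨⟨e⟩⟩ | ⟨⟨e⟩⟩ := h
  · exact (isDeficientWeight_pathGraph hn).index_lt_two hA hG e
  · exact (isDeficientWeight_dynkinD hn).index_lt_two hA hG e
  · exact isDeficientWeight_dynkinE6.index_lt_two hA hG e
  · exact isDeficientWeight_dynkinE7.index_lt_two hA hG e
  · exact isDeficientWeight_dynkinE8.index_lt_two hA hG e

lemma IsExtDynkin.index_eq_two {V : Type*} [Fintype V] [DecidableEq V] [Nonempty V]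
    {G : SimpleGraph V} [DecidableRel G.Adj] (hA : (G.adjMatrix ℝ).IsHermitian)
    (h : IsExtDynkin G) : (⨆ i, hA.eigenvalues i) = 2 := by
  obtain ⟨n, hn, ⟨e⟩⟩ | ⟨n, hn, ⟨e⟩⟩ | ⟨⟨e⟩⟩ | ⟨⟨e⟩⟩ | ⟨⟨e⟩⟩ := h
  · obtain ⟨n, rfl⟩ := Nat.exists_eq_add_of_le' hn
    exact (isNullWeight_cycleGraph n).index_eq_two hA e
  · exact (isNullWeight_extDynkinD hn).index_eq_two hA e
  · exact isNullWeight_extDynkinE6.index_eq_two hA e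
  · exact isNullWeight_extDynkinE7.index_eq_two hA e
  · exact isNullWeight_extDynkinE8.index_eq_two hA e

/-- Smith's theorem: for a finite connected simple graph, the index (largest
adjacency eigenvalue) is < 2 iff the graph is a Dynkin graph Aₙ, Dₙ, E₆, E₇, E₈,
and = 2 iff it is an extended Dynkin graph Ãₙ (a cycle), D̃ₙ, Ẽ₆, Ẽ₇, Ẽ₈. -/
theorem stmt_13 (V : Type) [Fintype V] [DecidableEq V] [Nonempty V]
    (G : SimpleGraph V) [DecidableRel G.Adj] (hG : G.Connected)
    (hA : (G.adjMatrix ℝ).IsHermitian)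
    (lam : ℝ) (hlam : lam = ⨆ i, hA.eigenvalues i) :
    (lam < 2 ↔
      (∃ n : ℕ, 1 ≤ n ∧ Nonempty (G ≃g pathGraph n)) ∨
      (∃ n : ℕ, 4 ≤ n ∧ Nonempty (G ≃g dynkinD n)) ∨
      Nonempty (G ≃g dynkinE 6) ∨ Nonempty (G ≃g dynkinE 7) ∨
      Nonempty (G ≃g dynkinE 8)) ∧
    (lam = 2 ↔
      (∃ n : ℕ, 3 ≤ n ∧ Nonempty (G ≃g cycleGraph n)) ∨
      (∃ n : ℕ, 4 ≤ n ∧ Nonempty (G ≃g extDynkinD n)) ∨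
      Nonempty (G ≃g extDynkinE6) ∨ Nonempty (G ≃g extDynkinE7) ∨
      Nonempty (G ≃g extDynkinE8)) := by
  subst hlam
  change (_ ↔ IsDynkin G) ∧ (_ ↔ IsExtDynkin G)
  refine ⟨⟨fun h => ?_, IsDynkin.index_lt_two hA hG⟩, ⟨fun h => ?_, IsExtDynkin.index_eq_two hA⟩⟩
  · exact (isDynkin_or_isExtDynkin_of_index_le_two hA hG h.le).resolve_right
      fun h' => h.ne (h'.index_eq_two hA)
  · exact (isDynkin_or_isExtDynkin_of_index_le_two hA hG h.le).resolve_left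
      fun h' => (h'.index_lt_two hA hG).ne h
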